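/- (Andrews; MacMahon's conjecture for symmetric plane partitions.) For all natural numbers a, c, the following identity holds in ℤ[q]: (∑_{T ∈ PP(a,a,c), τ(T)=T} q^{|T|}) · ∏_{i=1}^{a} (1 − q^{2i−1}) · ∏_{1 ≤ i < j ≤ a} (1 − q^{2(i+j−1)}) = ∏_{i=1}^{a} (1 − q^{c+2i−1}) · ∏_{1 ≤ i < j ≤ a} (1 − q^{2(c+i+j−1)}). -/

import Mathlib

open Finset

/-- A plane partition in an `a × b × c` box: a lower set of `Fin a × Fin b × Fin c`
for the componentwise order. -/
def IsPP (a b c : ℕ) (T : Finset (Fin a × Fin b × Fin c)) : Prop :=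
  ∀ p ∈ T, ∀ q : Fin a × Fin b × Fin c,
    q.1 ≤ p.1 → q.2.1 ≤ p.2.1 → q.2.2 ≤ p.2.2 → q ∈ T

set_option synthInstance.maxSize 400 in
instance (a b c : ℕ) : DecidablePred (IsPP a b c) := fun _ => by
  unfold IsPP; infer_instance

/-- Transposition of plane partitions in an `a × a × c` box:
`τ(T) = {(j,i,k) : (i,j,k) ∈ T}`. -/
def ppTau (a c : ℕ) (T : Finset (Fin a × Fin a × Fin c)) :
    Finset (Fin a × Fin a × Fin c) :=
  T.image fun p => (p.2.1, p.1, p.2.2)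

open Polynomial

section Determinants

open Matrix

variable {K : Type*} [Field K]

theorem sum_one_sub_mul_prod_div_eq {ι : Type*} [DecidableEq ι] (S : Finset ι) (x : ι → K)
    (hx : Set.InjOn x S) (hneg : ∀ i ∈ S, x i ≠ -1) :
    ∑ i ∈ S, (1 - x i) * ∏ j ∈ S.erase i, (1 - x i * x j) / (x j - x i) =
      1 - ∏ i ∈ S, x i := by
  classical
  set P : K[X] := ∏ j ∈ S, (1 - C (x j) * X) with hP
  let v : Option ι → K := fun o => o.elim (-1) x
  have hv : Set.InjOn v (insertNone S) := by
    rintro (_ | i) hi (_ | j) hj h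
    · rfl
    · exact absurd h.symm (hneg j (by simpa using hj))
    · exact absurd h (hneg i (by simpa using hi))
    · exact congrArg some (hx (by simpa using hi) (by simpa using hj) h)
  have hnat : ∀ j ∈ S, (1 - C (x j) * X : K[X]).natDegree ≤ 1 := fun j _ => by compute_degree
  have hdeg : P.degree < #(insertNone S) := by
    rw [card_insertNone]
    refine (degree_le_natDegree).trans_lt ?_
    have : P.natDegree ≤ #S := by
      simpa using (natDegree_prod_le S _).trans (Finset.sum_le_card_nsmul S _ 1 hnat)
    exact_mod_cast Nat.lt_succ_of_le this
  have hcoeff : P.coeff #S = (-1) ^ #S * ∏ i ∈ S, x i := by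
    have h := coeff_prod_of_natDegree_le S (fun j => (1 - C (x j) * X : K[X])) 1 hnat
    rw [mul_one] at h
    rw [hP, h, ← prod_const, ← prod_mul_distrib]
    refine prod_congr rfl fun j _ => ?_
    simp [coeff_one]
  have key := Lagrange.coeff_eq_sum hv hdeg
  have heval : ∀ z, P.eval z = ∏ j ∈ S, (1 - z * x j) := fun z => by
    rw [hP, eval_prod]
    exact prod_congr rfl fun j _ => by simp; ring
  rw [card_insertNone, Nat.add_sub_cancel, hcoeff, sum_insertNone] at key
  have hnone : P.eval (v none) / ∏ j ∈ (insertNone S).erase none, (v none - v j) = (-1) ^ #S := by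
    have herase : (insertNone S).erase none = S.map Function.Embedding.some := by
      ext (_ | j) <;> simp
    rw [herase, prod_map, heval, ← prod_div_distrib, ← prod_const]
    refine prod_congr rfl fun j hj => ?_
    have : (-1 : K) - x j ≠ 0 := fun h => hneg j hj (by linear_combination -h)
    rw [div_eq_iff (by simpa [v] using this)]
    simp [v, add_comm]
  have hsome : ∀ i ∈ S, P.eval (v (some i)) / ∏ j ∈ (insertNone S).erase (some i),
      (v (some i) - v j) = (-1) ^ #S * -((1 - x i) * ∏ j ∈ S.erase i,
        (1 - x i * x j) / (x j - x i)) := by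
    intro i hi
    have herase : (insertNone S).erase (some i) = insertNone (S.erase i) := by
      ext (_ | j) <;> simp
    have hpos : x i - -1 ≠ 0 := sub_ne_zero.2 (hneg i hi)
    have hcard : #S = #(S.erase i) + 1 := (card_erase_add_one hi).symm
    rw [herase, prod_insertNone, heval, ← mul_prod_erase S _ hi, hcard, pow_succ]
    have : ∏ j ∈ S.erase i, (1 - x i * x j) / (x j - x i) =
        (-1) ^ #(S.erase i) * ∏ j ∈ S.erase i, (1 - x i * x j) / (x i - x j) := by
      rw [← prod_const, ← prod_mul_distrib]
      refine prod_congr rfl fun j hj => ?_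
      rw [← neg_sub (x i), div_neg]
      ring
    rw [this, prod_div_distrib]
    have hsq : ((-1 : K) ^ #(S.erase i)) * (-1) ^ #(S.erase i) = 1 := by
      rw [← mul_pow]; simp
    have hden : ∏ j ∈ S.erase i, (x i - x j) ≠ 0 := prod_ne_zero_iff.2 fun j hj =>
      sub_ne_zero.2 fun h => (mem_erase.1 hj).1
        (hx hi (mem_erase.1 hj).2 h).symm
    simp only [v, Option.elim]
    rw [div_eq_iff (mul_ne_zero hpos hden)]
    field_simp
    linear_combination (-(1 - x i) * (x i + 1)) * (∏ j ∈ S.erase i, (1 - x i * x j)) * hsq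
  rw [hnone, sum_congr rfl hsome, ← mul_sum, sum_neg_distrib] at key
  have hne : ((-1 : K) ^ #S) ≠ 0 := pow_ne_zero _ (by simp)
  have := mul_left_cancel₀ hne (key.trans (by ring :
    _ = (-1 : K) ^ #S * (1 + -∑ i ∈ S, (1 - x i) * ∏ j ∈ S.erase i,
      (1 - x i * x j) / (x j - x i))))
  linear_combination this

theorem prod_prod_Ioi_succAbove {M : Type*} [CommMonoid M] {n : ℕ}
    (g : Fin (n + 1) → Fin (n + 1) → M) (i : Fin (n + 1)) :
    ∏ a, ∏ b ∈ Ioi a, g a b =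
      (∏ j, if i < i.succAbove j then g i (i.succAbove j) else g (i.succAbove j) i) *
        ∏ a, ∏ b ∈ Ioi a, g (i.succAbove a) (i.succAbove b) := by
  have h : ∀ {m : ℕ} (g : Fin m → Fin m → M),
      ∏ a, ∏ b ∈ Ioi a, g a b = ∏ a, ∏ b, if a < b then g a b else 1 := by
    intro m g
    refine prod_congr rfl fun a _ => ?_
    rw [← prod_filter]
    congr 1
    ext; simp
  rw [h, h, Fin.prod_univ_succAbove _ i, Fin.prod_univ_succAbove _ i]
  simp only [Fin.prod_univ_succAbove _ i, Fin.succAbove_lt_succAbove_iff, lt_irrefl, if_false,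
    one_mul]
  rw [prod_mul_distrib, ← mul_assoc, ← prod_mul_distrib]
  congr 1
  refine prod_congr rfl fun j _ => ?_
  rcases lt_or_gt_of_ne (Fin.succAbove_ne i j) with h | h
  · simp [h, h.not_gt]
  · simp [h, h.not_gt]

theorem prod_ite_lt_succAbove_neg_one {n : ℕ} (i : Fin (n + 1)) :
    (∏ j, if i < i.succAbove j then (1 : K) else -1) = (-1) ^ (i : ℕ) := by
  rw [prod_ite, prod_const_one, one_mul, prod_const]
  congr 1
  have : (univ.filter fun j : Fin n => ¬ i < i.succAbove j) =
      univ.filter fun j : Fin n => (j : ℕ) < i := by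
    ext j
    simp only [mem_filter, mem_univ, true_and, not_lt, Fin.succAbove, Fin.lt_def]
    split_ifs <;> simp_all
    omega
  rw [this, Fin.card_filter_val_lt]
  omega

theorem det_vandermonde_succAbove {n : ℕ} (v : Fin (n + 1) → K) (i : Fin (n + 1)) :
    (vandermonde v).det = (-1) ^ (i : ℕ) * (∏ j, (v (i.succAbove j) - v i)) *
      (vandermonde fun j => v (i.succAbove j)).det := by
  rw [det_vandermonde, det_vandermonde, prod_prod_Ioi_succAbove (fun a b => v b - v a) i,
    ← prod_ite_lt_succAbove_neg_one i]
  congr 1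
  rw [← prod_mul_distrib]
  refine prod_congr rfl fun j _ => ?_
  split_ifs <;> ring

/-- The numerator determinant in the bounded Littlewood identity. -/
def reflDet (n N : ℕ) (x : Fin n → K) : K :=
  (of fun j i : Fin n => x j ^ (n - 1 - i : ℕ) - x j ^ (N + i)).det

/-- The term of the expansion of `reflDet` that takes the power `x j ^ (N + i)` in the rows
with `s j = true`. -/
def reflTerm (n N : ℕ) (x : Fin n → K) (s : Fin n → Bool) : K :=
  (∏ j, if s j then -x j ^ N else x j ^ (n - 1)) *
    (vandermonde fun j => if s j then x j else (x j)⁻¹).det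

theorem reflDet_eq_sum (n N : ℕ) (x : Fin n → K) (h0 : ∀ j, x j ≠ 0) :
    reflDet n N x = ∑ s, reflTerm n N x s := by
  have := (detRowAlternating (n := Fin n) (R := K)).toMultilinearMap.map_sum
    (fun j (b : Bool) (i : Fin n) => if b then -x j ^ (N + i) else x j ^ (n - 1 - i : ℕ))
  have hl : reflDet n N x = (detRowAlternating (n := Fin n) (R := K)).toMultilinearMap
      (fun j => ∑ b : Bool, fun i : Fin n =>
        if b then -x j ^ (N + i) else x j ^ (n - 1 - i : ℕ)) := by
    unfold reflDet
    change Matrix.det _ = Matrix.det _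
    congr 1
    ext j i
    simp only [Fintype.sum_bool, of_apply, Pi.add_apply]
    simp
    ring
  rw [hl, this]
  refine sum_congr rfl fun s _ => ?_
  change Matrix.det _ = _
  rw [reflTerm, ← det_mul_column]
  congr 1
  ext j i
  simp only [of_apply, vandermonde_apply]
  cases s j
  · have h : n - 1 = (n - 1 - i) + i := by omega
    simp only [Bool.false_eq_true, if_false]
    rw [inv_pow]
    nth_rewrite 2 [h]
    rw [pow_add, mul_assoc, mul_inv_cancel₀ (pow_ne_zero _ (h0 j)), mul_one]
  · simp [pow_add]

theorem reflTerm_succAbove (n N : ℕ) (x : Fin (n + 1) → K) (h0 : ∀ j, x j ≠ 0)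
    (s : Fin (n + 1) → Bool) (i : Fin (n + 1)) (hi : s i = true) :
    reflTerm (n + 1) N x s = -((-1) ^ (i : ℕ) * x i ^ N *
      (∏ j, if s (i.succAbove j) then x (i.succAbove j) - x i else 1 - x i * x (i.succAbove j)) *
      reflTerm n N (fun j => x (i.succAbove j)) fun j => s (i.succAbove j)) := by
  unfold reflTerm
  rw [Fin.prod_univ_succAbove _ i, det_vandermonde_succAbove _ i]
  have : (∏ j, if s (i.succAbove j) then -x (i.succAbove j) ^ N
        else x (i.succAbove j) ^ (n + 1 - 1)) *
      (∏ j, ((if s (i.succAbove j) then x (i.succAbove j) else (x (i.succAbove j))⁻¹) -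
        if s i then x i else (x i)⁻¹)) =
      (∏ j, if s (i.succAbove j) then x (i.succAbove j) - x i
        else 1 - x i * x (i.succAbove j)) *
      ∏ j, if s (i.succAbove j) then -x (i.succAbove j) ^ N
        else x (i.succAbove j) ^ (n - 1) := by
    rw [← prod_mul_distrib, ← prod_mul_distrib]
    refine prod_congr rfl fun j _ => ?_
    have hj := h0 (i.succAbove j)
    have hn : n + 1 - 1 = (n - 1) + 1 := by have := j.pos; omega
    rw [hn]
    cases s (i.succAbove j)
    · simp only [hi, Bool.false_eq_true, if_false, if_true, pow_succ]
      field_simp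
    · simp only [hi, if_true]
      ring
  simp only [hi, if_true] at this ⊢
  linear_combination (-x i ^ N) * (-1) ^ (i : ℕ) * (vandermonde fun j =>
    if s (i.succAbove j) then x (i.succAbove j) else (x (i.succAbove j))⁻¹).det * this

theorem reflDet_succ (n N : ℕ) (x : Fin (n + 1) → K) (h0 : ∀ j, x j ≠ 0)
    (hneg : ∀ j, x j ≠ -1) (hinj : Function.Injective x) :
    reflDet (n + 1) (N + 1) x = reflDet (n + 1) N x +
      ∑ i : Fin (n + 1), (-1) ^ (i : ℕ) * x i ^ N * (1 - x i) *
        (∏ j, (1 - x i * x (i.succAbove j))) *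
        reflDet n N fun j => x (i.succAbove j) := by
  have hterm : ∀ s : Fin (n + 1) → Bool, reflTerm (n + 1) (N + 1) x s =
      (∏ j, if s j then x j else 1) * reflTerm (n + 1) N x s := by
    intro s
    unfold reflTerm
    rw [← mul_assoc, ← prod_mul_distrib]
    congr 1
    refine prod_congr rfl fun j _ => ?_
    split_ifs <;> ring
  have hsum : ∀ i : Fin (n + 1), (-1) ^ (i : ℕ) * x i ^ N * (1 - x i) *
      (∏ j, (1 - x i * x (i.succAbove j))) * (reflDet n N fun j => x (i.succAbove j)) =
      ∑ s : Fin (n + 1) → Bool, if s i then -((1 - x i) * (∏ j ∈ ({j | s j} : Finset _).erase i,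
        (1 - x i * x j) / (x j - x i)) * reflTerm (n + 1) N x s) else 0 := by
    intro i
    rw [reflDet_eq_sum _ _ _ fun j => h0 _, mul_sum,
      ← (Fin.insertNthEquiv (fun _ => Bool) i).sum_comp, Fintype.sum_prod_type,
      Fintype.sum_bool]
    simp only [Fin.insertNthEquiv_apply, Fin.insertNth_apply_same, if_true, Bool.false_eq_true,
      if_false, sum_const_zero, add_zero]
    refine sum_congr rfl fun s _ => ?_
    rw [reflTerm_succAbove n N x h0 _ i (by simp)]
    simp only [Fin.insertNthEquiv_apply, Fin.insertNth_apply_succAbove]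
    have hprod : (∏ j ∈ ({j | (Fin.insertNth (α := fun _ => Bool) i true s : Fin (n + 1) → Bool) j}
        : Finset (Fin (n + 1))).erase i, (1 - x i * x j) / (x j - x i)) =
        ∏ j, if s j then (1 - x i * x (i.succAbove j)) / (x (i.succAbove j) - x i) else 1 := by
      have he : ({j | (Fin.insertNth (α := fun _ => Bool) i true s : Fin (n + 1) → Bool) j}
          : Finset (Fin (n + 1))).erase i =
          (univ.filter fun j => s j).map (Fin.succAboveEmb i) := by
        ext j
        rcases Fin.eq_self_or_eq_succAbove i j with rfl | ⟨k, rfl⟩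
        · simp [Fin.succAbove_ne]
        · simp [Fin.succAbove_ne]
      rw [he, prod_map, prod_filter]
      rfl
    rw [hprod]
    have h2 : (∏ j, if s j then (1 - x i * x (i.succAbove j)) / (x (i.succAbove j) - x i)
          else 1) * (∏ j, if s j then x (i.succAbove j) - x i
            else 1 - x i * x (i.succAbove j)) = ∏ j, (1 - x i * x (i.succAbove j)) := by
      rw [← prod_mul_distrib]
      refine prod_congr rfl fun j _ => ?_
      split_ifs
      · exact div_mul_cancel₀ _ (sub_ne_zero.2 fun h => Fin.succAbove_ne i j (hinj h))
      · rw [one_mul]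
    rw [← h2]
    ring
  rw [sum_congr rfl fun i _ => hsum i, sum_comm, reflDet_eq_sum _ _ _ h0,
    reflDet_eq_sum _ _ _ h0, ← sum_add_distrib]
  refine sum_congr rfl fun s _ => ?_
  have key := sum_one_sub_mul_prod_div_eq (univ.filter fun j => s j = true) x hinj.injOn
    fun j _ => hneg j
  rw [← sum_filter, sum_neg_distrib, ← sum_mul, key, hterm, prod_filter]
  ring

theorem reflDet_zero_right (n : ℕ) (x : Fin (n + 1) → K) : reflDet (n + 1) 0 x = 0 := by
  unfold reflDet
  rw [← exists_mulVec_eq_zero_iff]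
  refine ⟨fun _ => 1, fun h => one_ne_zero (congrFun h 0), ?_⟩
  ext j
  simp only [mulVec, dotProduct, of_apply, mul_one, Pi.zero_apply, sum_sub_distrib, zero_add]
  rw [sub_eq_zero, ← Equiv.sum_comp Fin.revPerm]
  refine sum_congr rfl fun i _ => ?_
  congr 1
  simp [Fin.val_rev]
  omega

end Determinants

section BoundedLittlewood

open Matrix

variable {K : Type*} [Field K]

open Classical in
/-- The strictly decreasing `n`-tuples of natural numbers smaller than `N`. -/
noncomputable def strictAntiTuples (n N : ℕ) : Finset (Fin n → ℕ) :=
  (Fintype.piFinset fun _ => range N).filter StrictAnti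

theorem mem_strictAntiTuples {n N : ℕ} {l : Fin n → ℕ} :
    l ∈ strictAntiTuples n N ↔ (∀ i, l i < N) ∧ StrictAnti l := by
  simp [strictAntiTuples]

theorem sum_strictAntiTuples_succ {M : Type*} [AddCommMonoid M] (n N : ℕ)
    (f : (Fin (n + 1) → ℕ) → M) :
    ∑ l ∈ strictAntiTuples (n + 1) (N + 1), f l = ∑ l ∈ strictAntiTuples (n + 1) N, f l +
      ∑ l ∈ strictAntiTuples n N, f (Fin.cons N l) := by
  rw [← sum_filter_not_add_sum_filter (strictAntiTuples (n + 1) (N + 1)) fun l => l 0 = N]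
  congr 1
  · refine sum_congr ?_ fun _ _ => rfl
    ext l
    simp only [mem_filter, mem_strictAntiTuples]
    constructor
    · rintro ⟨⟨h, hl⟩, h0⟩
      refine ⟨fun i => ?_, hl⟩
      have := hl.antitone (Fin.zero_le i)
      have := h 0
      omega
    · rintro ⟨h, hl⟩
      exact ⟨⟨fun i => (h i).trans (Nat.lt_succ_self N), hl⟩, (h 0).ne⟩
  · refine sum_bij' (fun l _ => Fin.tail l) (fun l _ => Fin.cons N l) ?_ ?_ ?_ ?_ ?_
    · intro l hl
      simp only [mem_filter, mem_strictAntiTuples] at hl ⊢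
      obtain ⟨⟨h, hl⟩, h0⟩ := hl
      exact ⟨fun i => h0 ▸ hl (Fin.succ_pos i), fun i j hij => hl (Fin.succ_lt_succ_iff.2 hij)⟩
    · intro l hl
      simp only [mem_filter, mem_strictAntiTuples] at hl ⊢
      obtain ⟨h, hl⟩ := hl
      refine ⟨⟨fun i => ?_, fun i j hij => ?_⟩, rfl⟩
      · cases i using Fin.cases with
        | zero => simp
        | succ i => simpa using (h i).trans (Nat.lt_succ_self N)
      · cases j using Fin.cases with
        | zero => exact absurd hij (Fin.not_lt_zero i)
        | succ j =>
          cases i using Fin.cases with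
          | zero => simpa using h j
          | succ i => simpa using hl (Fin.succ_lt_succ_iff.1 hij)
    · intro l hl
      simp only [mem_filter] at hl
      rw [← hl.2]
      exact Fin.cons_self_tail l
    · intro l _
      exact Fin.tail_cons _ _
    · intro l hl
      simp only [mem_filter] at hl
      rw [← hl.2, Fin.cons_self_tail]

/-- The sum of all alternants in `x` with exponents smaller than `N`. -/
noncomputable def alternantSum (n N : ℕ) (x : Fin n → K) : K :=
  ∑ l ∈ strictAntiTuples n N, (of fun i j => x i ^ l j).det

theorem alternantSum_succ (n N : ℕ) (x : Fin (n + 1) → K) :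
    alternantSum (n + 1) (N + 1) x = alternantSum (n + 1) N x +
      ∑ i : Fin (n + 1), (-1) ^ (i : ℕ) * x i ^ N *
        alternantSum n N fun j => x (i.succAbove j) := by
  unfold alternantSum
  rw [sum_strictAntiTuples_succ]
  congr 1
  simp only [mul_sum]
  rw [sum_comm]
  refine sum_congr rfl fun l _ => ?_
  rw [det_succ_column_zero]
  refine sum_congr rfl fun i _ => ?_
  simp only [of_apply, Fin.cons_zero]
  congr 1

/-- The denominator in the bounded Littlewood identity. -/
def reflDenom (n : ℕ) (x : Fin n → K) : K :=
  (∏ i, (1 - x i)) * ∏ a, ∏ b ∈ Ioi a, (1 - x a * x b)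

theorem reflDenom_succAbove (n : ℕ) (x : Fin (n + 1) → K) (i : Fin (n + 1)) :
    reflDenom (n + 1) x = (1 - x i) * (∏ j, (1 - x i * x (i.succAbove j))) *
      reflDenom n fun j => x (i.succAbove j) := by
  unfold reflDenom
  rw [Fin.prod_univ_succAbove _ i, prod_prod_Ioi_succAbove (fun a b => 1 - x a * x b) i]
  have : (∏ j, if i < i.succAbove j then 1 - x i * x (i.succAbove j)
      else 1 - x (i.succAbove j) * x i) = ∏ j, (1 - x i * x (i.succAbove j)) :=
    prod_congr rfl fun j _ => by split_ifs <;> ring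
  rw [this]
  ring

/-- The bounded Littlewood identity. -/
theorem alternantSum_mul_reflDenom (n N : ℕ) (x : Fin n → K) (h0 : ∀ j, x j ≠ 0)
    (hneg : ∀ j, x j ≠ -1) (hinj : Function.Injective x) :
    alternantSum n N x * reflDenom n x = reflDet n N x := by
  induction N generalizing n with
  | zero =>
    cases n with
    | zero => simp [alternantSum, reflDenom, reflDet, strictAntiTuples, Subsingleton.strictAnti]
    | succ n => simp [alternantSum, reflDet_zero_right, strictAntiTuples]
  | succ N ih =>
    cases n with
    | zero => simp [alternantSum, reflDenom, reflDet, strictAntiTuples, Subsingleton.strictAnti]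
    | succ n =>
      rw [alternantSum_succ, reflDet_succ n N x h0 hneg hinj, add_mul, ih _ x h0 hneg hinj,
        sum_mul]
      congr 1
      refine sum_congr rfl fun i _ => ?_
      rw [← ih n _ (fun j => h0 _) (fun j => hneg _) (hinj.comp Fin.succAbove_right_injective),
        reflDenom_succAbove n x i]
      ring

/-- The monic polynomial `p` with `p (v + v⁻¹) = ∑_{k = -m}^{m} v ^ k`. -/
noncomputable def oddChebyshev (K : Type*) [Field K] : ℕ → K[X]
  | 0 => 1
  | 1 => X + 1
  | m + 2 => X * oddChebyshev K (m + 1) - oddChebyshev K m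

theorem oddChebyshev_monic_natDegree (m : ℕ) :
    ((oddChebyshev K m).Monic ∧ (oddChebyshev K m).natDegree = m) ∧
      (oddChebyshev K (m + 1)).Monic ∧ (oddChebyshev K (m + 1)).natDegree = m + 1 := by
  induction m with
  | zero =>
    refine ⟨by simp [oddChebyshev], ?_, ?_⟩
    · simpa [oddChebyshev] using monic_X_add_C (1 : K)
    · simpa [oddChebyshev] using natDegree_X_add_C (1 : K)
  | succ m ih =>
    refine ⟨ih.2, ?_⟩
    obtain ⟨⟨h1, h2⟩, h3, h4⟩ := ih
    have hX : (X * oddChebyshev K (m + 1)).Monic := monic_X.mul h3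
    have hXd : (X * oddChebyshev K (m + 1)).natDegree = m + 2 := by
      rw [monic_X.natDegree_mul h3, natDegree_X, h4]; ring
    have hlt : (oddChebyshev K m).degree < (X * oddChebyshev K (m + 1)).degree := by
      rw [degree_eq_natDegree h1.ne_zero, degree_eq_natDegree hX.ne_zero, h2, hXd]
      exact_mod_cast (by omega : m < m + 2)
    simp only [oddChebyshev]
    exact ⟨hX.sub_of_left hlt, by rw [natDegree_sub_eq_left_of_natDegree_lt (by omega), hXd]⟩

theorem oddChebyshev_eval (v : K) (hv : v ≠ 0) (m : ℕ) :
    v ^ m * (1 - v) * (oddChebyshev K m).eval (v + v⁻¹) = 1 - v ^ (2 * m + 1) := by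
  induction m using Nat.twoStepInduction with
  | zero => simp [oddChebyshev]
  | one => simp only [oddChebyshev, eval_add, eval_X, eval_one]; field_simp; ring
  | more m h1 h2 =>
    simp only [oddChebyshev, eval_sub, eval_mul, eval_X]
    have : v ^ (m + 2) * (v + v⁻¹) = v ^ (m + 1) * (v ^ 2 + 1) := by field_simp; ring
    linear_combination (1 - v) * (oddChebyshev K (m + 1)).eval (v + v⁻¹) * this +
      (v ^ 2 + 1) * h2 - v ^ 2 * h1

theorem prod_pow_mul_prod_prod_Ioi_inv (n : ℕ) (z : K) (hz : z ≠ 0) :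
    (∏ j : Fin n, z ^ (j : ℕ)) * ∏ a : Fin n, ∏ _b ∈ Ioi a, z⁻¹ = 1 := by
  rw [← Equiv.prod_comp Fin.revPerm fun j : Fin n => z ^ (j : ℕ), ← prod_mul_distrib]
  refine prod_eq_one fun a _ => ?_
  rw [prod_const, Fin.card_Ioi, inv_pow, Fin.revPerm_apply, Fin.val_rev]
  rw [show n - (a + 1 : ℕ) = n - 1 - a by omega]
  exact mul_inv_cancel₀ (pow_ne_zero _ hz)

theorem exists_reflDet_odd_pow_eq (n : ℕ) (q : K) (hq : q ≠ 0)
    (hinj : Function.Injective fun k : ℕ => q ^ k) :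
    ∃ C : K, C ≠ 0 ∧ ∀ c : ℕ, reflDet n (n + c) (fun j => q ^ (2 * (j : ℕ) + 1)) =
      C * ((∏ i : Fin n, (1 - q ^ (c + 2 * (i : ℕ) + 1))) *
        ∏ a : Fin n, ∏ b ∈ Ioi a, (1 - q ^ (2 * (c + (a : ℕ) + b + 1)))) := by
  let r : Fin n → Fin n → K := fun a b =>
    (q ^ (2 * (a : ℕ) + 1) - q ^ (2 * (b : ℕ) + 1)) / q ^ (2 * (a : ℕ) + 2 * b + 2)
  refine ⟨(∏ i : Fin n, q ^ (n - 1 - i : ℕ)) * (∏ j : Fin n, q ^ ((2 * n - 1) * (j : ℕ))) *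
    ∏ a : Fin n, ∏ b ∈ Ioi a, r a b, ?_, fun c => ?_⟩
  · refine mul_ne_zero (mul_ne_zero ?_ ?_) ?_
    · exact prod_ne_zero_iff.2 fun _ _ => pow_ne_zero _ hq
    · exact prod_ne_zero_iff.2 fun _ _ => pow_ne_zero _ hq
    · refine prod_ne_zero_iff.2 fun a _ => prod_ne_zero_iff.2 fun b hb => ?_
      refine div_ne_zero (sub_ne_zero.2 fun h => ?_) (pow_ne_zero _ hq)
      have := hinj h
      have := Fin.lt_def.1 (mem_Ioi.1 hb)
      omega
  let v : Fin n → K := fun i => q ^ (c + 2 * (i : ℕ) + 1)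
  let u : Fin n → K := fun i => v i + (v i)⁻¹
  have hdet : reflDet n (n + c) (fun j => q ^ (2 * (j : ℕ) + 1)) =
      (∏ i : Fin n, q ^ (n - 1 - i : ℕ) * (1 - v i)) *
        ((∏ j : Fin n, q ^ ((c + 2 * n - 1) * (j : ℕ))) * (vandermonde u).det) := by
    rw [det_eval_matrixOfPolynomials_eq_det_vandermonde u (fun j => oddChebyshev K j)
      (fun j => (oddChebyshev_monic_natDegree _).1.2)
      (fun j => (oddChebyshev_monic_natDegree _).1.1), ← det_transpose, ← det_mul_column,
      ← det_mul_row, reflDet]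
    congr 1
    ext j i
    simp only [of_apply, transpose_apply]
    have h := oddChebyshev_eval (v i) (pow_ne_zero _ hq) j
    have e1 : (q ^ (2 * (j : ℕ) + 1)) ^ (n + c + i) =
        (q ^ (2 * (j : ℕ) + 1)) ^ (n - 1 - i : ℕ) * v i ^ (2 * (j : ℕ) + 1) := by
      simp only [v, ← pow_mul, ← pow_add]
      congr 1
      rw [mul_comm (c + 2 * (i : ℕ) + 1), ← mul_add]
      congr 1
      omega
    have e2 : (q ^ (2 * (j : ℕ) + 1)) ^ (n - 1 - i : ℕ) * v i ^ (j : ℕ) =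
        q ^ (n - 1 - i : ℕ) * q ^ ((c + 2 * n - 1) * (j : ℕ)) := by
      simp only [v, ← pow_mul, ← pow_add]
      congr 1
      obtain ⟨k, hk⟩ : ∃ k, n - 1 - (i : ℕ) = k := ⟨_, rfl⟩
      have : c + 2 * n - 1 = 2 * k + (c + 2 * i + 1) := by omega
      rw [hk, this]
      ring
    rw [e1]
    linear_combination (-(q ^ (2 * (j : ℕ) + 1)) ^ (n - 1 - i : ℕ)) * h +
      (1 - v i) * (oddChebyshev K j).eval (v i + (v i)⁻¹) * e2
  have hu : (vandermonde u).det = (∏ a : Fin n, ∏ b ∈ Ioi a, (q ^ c)⁻¹) *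
      ((∏ a : Fin n, ∏ b ∈ Ioi a, r a b) *
        ∏ a : Fin n, ∏ b ∈ Ioi a, (1 - q ^ (2 * (c + (a : ℕ) + b + 1)))) := by
    simp only [det_vandermonde, ← prod_mul_distrib]
    refine prod_congr rfl fun a _ => prod_congr rfl fun b _ => ?_
    simp only [u, v, r]
    field_simp
    ring
  have hc : ∏ j : Fin n, q ^ ((c + 2 * n - 1) * (j : ℕ)) =
      (∏ j : Fin n, q ^ ((2 * n - 1) * (j : ℕ))) * ∏ j : Fin n, (q ^ c) ^ (j : ℕ) := by
    rw [← prod_mul_distrib]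
    refine prod_congr rfl fun j _ => ?_
    rw [← pow_mul, ← pow_add, ← add_mul]
    have := j.pos
    congr 2
    omega
  rw [hdet, hu, hc, prod_mul_distrib]
  linear_combination (∏ i : Fin n, q ^ (n - 1 - i : ℕ)) * (∏ i, (1 - v i)) *
    (∏ j : Fin n, q ^ ((2 * n - 1) * (j : ℕ))) * ((∏ a : Fin n, ∏ b ∈ Ioi a, r a b) *
        ∏ a : Fin n, ∏ b ∈ Ioi a, (1 - q ^ (2 * (c + (a : ℕ) + b + 1)))) *
    prod_pow_mul_prod_prod_Ioi_inv n (q ^ c) (pow_ne_zero _ hq)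

end BoundedLittlewood

section InterlacingSums

open Matrix

variable {K : Type*} [Field K]

/-- The generating function of the symmetric arrays with main diagonal `d`, computed one
diagonal at a time. -/
def interlacingSum (q : K) : (n : ℕ) → (Fin n → ℕ) → K
  | 0, _ => 1
  | n + 1, d => q ^ (∑ i, d i) *
      ∑ e ∈ Fintype.piFinset fun i : Fin n => Icc (d i.succ) (d i.castSucc),
        q ^ (∑ i, e i) * interlacingSum q n e

theorem one_sub_mul_sum_Icc_pow_add (y : K) {a b : ℕ} (hab : a ≤ b) (e : ℕ) :
    (1 - y) * ∑ m ∈ Icc a b, y ^ (m + e) = y ^ (a + e) - y ^ (b + (e + 1)) := by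
  induction b, hab using Nat.le_induction with
  | base => simp; ring
  | succ b hab ih =>
    rw [← insert_Icc_right_eq_Icc_add_one (by omega), sum_insert (by simp), mul_add, ih]
    ring

theorem det_pow_eq_det_sub_pow {n : ℕ} (y : ℕ → K) (hy : y 0 = 1) (l : Fin (n + 1) → ℕ) :
    (of fun j i : Fin (n + 1) => y i ^ l j).det =
      (of fun j i : Fin n => y (i + 1) ^ l j.succ - y (i + 1) ^ l j.castSucc).det := by
  rw [det_eq_of_forall_row_eq_smul_add_pred (B := of fun j i : Fin (n + 1) =>
    Fin.cases (y i ^ l 0) (fun k => y i ^ l k.succ - y i ^ l k.castSucc) j) (fun _ => 1)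
    (fun i => by simp) (fun k i => by simp), det_succ_column_zero, Fin.sum_univ_succ]
  simp [hy]
  rfl

theorem sum_add_sub_eq {n : ℕ} (d : Fin n → ℕ) (q : K) :
    q ^ (∑ i, d i) * q ^ (∑ i : Fin n, (n - 1 - i : ℕ)) =
      ∏ i : Fin n, q ^ (d i + (n - 1 - i : ℕ)) := by
  rw [← pow_add, ← sum_add_distrib, prod_pow_eq_pow_sum]

theorem antitone_of_mem_piFinset_Icc {n : ℕ} {d : Fin (n + 1) → ℕ} (hd : Antitone d)
    {e : Fin n → ℕ} (he : e ∈ Fintype.piFinset fun i : Fin n => Icc (d i.succ) (d i.castSucc)) :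
    Antitone e := by
  intro i j hij
  simp only [Fintype.mem_piFinset, mem_Icc] at he
  rcases hij.eq_or_lt with rfl | hij
  · exact le_rfl
  · exact ((he j).2.trans (hd (Fin.le_def.2 (by simpa using Fin.lt_def.1 hij)))).trans (he i).1

theorem exists_interlacingSum_eq (q : K) (hq : q ≠ 0)
    (hinj : Function.Injective fun k : ℕ => q ^ k) (n : ℕ) :
    ∃ C : K, C ≠ 0 ∧ ∀ d : Fin n → ℕ, Antitone d → C * interlacingSum q n d =
      (of fun i j : Fin n => (q ^ (2 * (i : ℕ) + 1)) ^ (d j + (n - 1 - j : ℕ))).det := by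
  induction n with
  | zero => exact ⟨1, one_ne_zero, fun d _ => by simp [interlacingSum]⟩
  | succ n ih =>
    obtain ⟨C, hC, ih⟩ := ih
    refine ⟨(∏ i : Fin n, (1 - q ^ (2 * ((i : ℕ) + 1)))) * C *
      q ^ (∑ i : Fin n, (n - 1 - i : ℕ)) * q ^ (∑ i : Fin (n + 1), (n + 1 - 1 - i : ℕ)), ?_,
      fun d hd => ?_⟩
    · refine mul_ne_zero (mul_ne_zero (mul_ne_zero (prod_ne_zero_iff.2 fun i _ h => ?_) hC)
        (pow_ne_zero _ hq)) (pow_ne_zero _ hq)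
      have := hinj (show q ^ 0 = q ^ (2 * ((i : ℕ) + 1)) by rw [pow_zero]; exact sub_eq_zero.1 h)
      omega
    have hterm : ∀ e ∈ Fintype.piFinset fun i : Fin n => Icc (d i.succ) (d i.castSucc),
        C * q ^ (∑ i : Fin n, (n - 1 - i : ℕ)) * (q ^ (∑ i, e i) * interlacingSum q n e) =
        detRowAlternating.toMultilinearMap fun j (i : Fin n) =>
          (q ^ (2 * ((i : ℕ) + 1))) ^ (e j + (n - 1 - j : ℕ)) := by
      intro e he
      change _ = Matrix.det _
      have h := sum_add_sub_eq e q
      have h2 := ih e (antitone_of_mem_piFinset_Icc hd he)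
      rw [show C * q ^ (∑ i : Fin n, (n - 1 - i : ℕ)) *
        (q ^ (∑ i, e i) * interlacingSum q n e) = (q ^ (∑ i, e i) *
          q ^ (∑ i : Fin n, (n - 1 - i : ℕ))) * (C * interlacingSum q n e) by ring, h, h2,
        ← det_mul_row, ← det_transpose]
      congr 1
      ext j i
      simp only [transpose_apply, of_apply, ← pow_mul, ← pow_add]
      congr 1
      ring
    have hsum : (∏ i : Fin n, (1 - q ^ (2 * ((i : ℕ) + 1)))) * (C *
        q ^ (∑ i : Fin n, (n - 1 - i : ℕ)) *
        ∑ e ∈ Fintype.piFinset fun i : Fin n => Icc (d i.succ) (d i.castSucc),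
          q ^ (∑ i, e i) * interlacingSum q n e) =
        (of fun j i : Fin (n + 1) => (q ^ (2 * (i : ℕ))) ^ (d j + (n - j : ℕ))).det := by
      rw [mul_sum, sum_congr rfl hterm, ← MultilinearMap.map_sum_finset
        (detRowAlternating (n := Fin n) (R := K)).toMultilinearMap (fun j m (i : Fin n) =>
          (q ^ (2 * ((i : ℕ) + 1))) ^ (m + (n - 1 - j : ℕ)))]
      change _ * Matrix.det (of fun j : Fin n => ∑ m ∈ Icc (d j.succ) (d j.castSucc),
        fun i : Fin n => (q ^ (2 * ((i : ℕ) + 1))) ^ (m + (n - 1 - j : ℕ))) = _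
      rw [← det_mul_row, det_pow_eq_det_sub_pow (fun i => q ^ (2 * i)) (by simp)]
      congr 1
      ext j i
      simp only [of_apply, Finset.sum_apply]
      rw [one_sub_mul_sum_Icc_pow_add _ (hd (Fin.castSucc_le_succ j))]
      simp only [Fin.val_succ, Fin.val_castSucc]
      congr 3 <;> omega
    have h := sum_add_sub_eq d q
    simp only [Nat.add_sub_cancel] at h ⊢
    rw [interlacingSum]
    have hdet : (of fun i j : Fin (n + 1) =>
        (q ^ (2 * (i : ℕ) + 1)) ^ (d j + (n - j : ℕ))).det =
        (∏ i : Fin (n + 1), q ^ (d i + (n - i : ℕ))) *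
        (of fun j i : Fin (n + 1) => (q ^ (2 * (i : ℕ))) ^ (d j + (n - j : ℕ))).det := by
      rw [← det_transpose, ← det_mul_column]
      congr 1
      ext j i
      simp only [transpose_apply, of_apply, ← pow_mul, ← pow_add]
      congr 1
      ring
    rw [hdet, ← h, ← hsum]
    ring

end InterlacingSums

section SymmetricArrays

/-- The symmetric `n × n` arrays with entries at most `c` that decrease weakly along rows and
columns. -/
def symArrays (n c : ℕ) : Finset (Fin n → Fin n → ℕ) :=
  (Fintype.piFinset fun _ => Fintype.piFinset fun _ => range (c + 1)).filter fun H =>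
    (∀ i j, H i j = H j i) ∧ ∀ j, Antitone fun i => H i j

theorem mem_symArrays {n c : ℕ} {H : Fin n → Fin n → ℕ} :
    H ∈ symArrays n c ↔
      (∀ i j, H i j ≤ c) ∧ (∀ i j, H i j = H j i) ∧ ∀ j, Antitone fun i => H i j := by
  simp [symArrays]

theorem le_of_mem_symArrays {n c : ℕ} {H : Fin n → Fin n → ℕ} (hH : H ∈ symArrays n c)
    {i i' j j' : Fin n} (hi : i ≤ i') (hj : j ≤ j') : H i' j' ≤ H i j := by
  obtain ⟨-, hsym, hanti⟩ := mem_symArrays.1 hH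
  calc H i' j' ≤ H i j' := hanti j' hi
    _ = H j' i := hsym _ _
    _ ≤ H j i := hanti i hj
    _ = H i j := hsym _ _

/-- Remove the main diagonal of a symmetric array. -/
def peelDiag {n : ℕ} (H : Fin (n + 1) → Fin (n + 1) → ℕ) (i j : Fin n) : ℕ :=
  H (min i j).castSucc (max i j).succ

/-- Add a main diagonal to a symmetric array. -/
def attachDiag {n : ℕ} (d : Fin (n + 1) → ℕ) (H : Fin n → Fin n → ℕ) (i j : Fin (n + 1)) : ℕ :=
  if i = j then d i
  else if h : (min i j : ℕ) < n ∧ (max i j : ℕ) - 1 < n then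
    H ⟨min (i : ℕ) j, h.1⟩ ⟨max (i : ℕ) j - 1, h.2⟩
  else 0

theorem attachDiag_self {n : ℕ} (d : Fin (n + 1) → ℕ) (H : Fin n → Fin n → ℕ)
    (i : Fin (n + 1)) : attachDiag d H i i = d i := by
  simp [attachDiag]

theorem attachDiag_comm {n : ℕ} (d : Fin (n + 1) → ℕ) (H : Fin n → Fin n → ℕ)
    (i j : Fin (n + 1)) : attachDiag d H i j = attachDiag d H j i := by
  by_cases h : i = j
  · rw [h]
  · simp [attachDiag, h, Ne.symm h, min_comm (i : ℕ), max_comm (i : ℕ)]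

theorem attachDiag_castSucc_succ {n : ℕ} (d : Fin (n + 1) → ℕ) (H : Fin n → Fin n → ℕ)
    {i j : Fin n} (hij : i ≤ j) : attachDiag d H i.castSucc j.succ = H i j := by
  have hij' : (i : ℕ) ≤ j := hij
  have hne : i.castSucc ≠ j.succ := fun h => by
    have := congrArg Fin.val h
    simp at this
    omega
  have hmin : min (i.castSucc : ℕ) j.succ = i := by simp; omega
  have hmax : max (i.castSucc : ℕ) j.succ - 1 = j := by simp; omega
  simp only [attachDiag, hne, if_false, hmin, hmax]
  simp

theorem exists_castSucc_succ {n : ℕ} {i j : Fin (n + 1)} (hij : i < j) :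
    ∃ a b : Fin n, a ≤ b ∧ i = a.castSucc ∧ j = b.succ := by
  have h : (i : ℕ) < j := hij
  exact ⟨⟨i, by omega⟩, ⟨j - 1, by omega⟩, Fin.le_def.2 (by simp; omega), by ext; simp,
    by ext; simp; omega⟩

theorem peelDiag_mem {n c : ℕ} {H : Fin (n + 1) → Fin (n + 1) → ℕ}
    (hH : H ∈ symArrays (n + 1) c) : peelDiag H ∈ symArrays n c := by
  refine mem_symArrays.2 ⟨fun i j => (mem_symArrays.1 hH).1 _ _, fun i j => ?_,
    fun j i i' hi => ?_⟩
  · rw [peelDiag, peelDiag, min_comm, max_comm]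
  · exact le_of_mem_symArrays hH (Fin.castSucc_le_castSucc_iff.2 (min_le_min_right _ hi))
      (Fin.succ_le_succ_iff.2 (max_le_max_right _ hi))

theorem attachDiag_mem {n c : ℕ} {d : Fin (n + 1) → ℕ} (hd : ∀ i, d i ≤ c)
    {H : Fin n → Fin n → ℕ} (hH : H ∈ symArrays n c)
    (hdH : ∀ i, d i.succ ≤ H i i ∧ H i i ≤ d i.castSucc) :
    attachDiag d H ∈ symArrays (n + 1) c := by
  refine mem_symArrays.2 ⟨fun i j => ?_, attachDiag_comm d H, fun j => ?_⟩
  · rcases lt_trichotomy i j with h | rfl | h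
    · obtain ⟨a, b, hab, rfl, rfl⟩ := exists_castSucc_succ h
      rw [attachDiag_castSucc_succ d H hab]
      exact (mem_symArrays.1 hH).1 _ _
    · rw [attachDiag_self]
      exact hd i
    · obtain ⟨a, b, hab, rfl, rfl⟩ := exists_castSucc_succ h
      rw [attachDiag_comm, attachDiag_castSucc_succ d H hab]
      exact (mem_symArrays.1 hH).1 _ _
  · rw [Fin.antitone_iff_succ_le]
    intro i
    rcases lt_trichotomy j i.castSucc with h | rfl | h
    · obtain ⟨a, b, hab, rfl, hb⟩ := exists_castSucc_succ h
      rw [attachDiag_comm, attachDiag_comm _ _ i.castSucc, hb, attachDiag_castSucc_succ d H hab,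
        attachDiag_castSucc_succ d H]
      · exact le_of_mem_symArrays hH le_rfl (Fin.le_def.2 (by
          have := congrArg Fin.val hb; simp at this; omega))
      · exact Fin.le_def.2 (by have := congrArg Fin.val hb; simp at this; omega)
    · rw [attachDiag_comm, attachDiag_castSucc_succ d H le_rfl, attachDiag_self]
      exact (hdH i).2
    · rcases (Fin.castSucc_lt_iff_succ_le.1 h).eq_or_lt with rfl | h
      · rw [attachDiag_castSucc_succ d H le_rfl, attachDiag_self]
        exact (hdH i).1
      · obtain ⟨a, b, hab, ha, rfl⟩ := exists_castSucc_succ h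
        have := congrArg Fin.val ha
        simp at this
        rw [ha, attachDiag_castSucc_succ d H hab, attachDiag_castSucc_succ d H]
        · exact le_of_mem_symArrays hH (Fin.le_def.2 (by omega)) le_rfl
        · exact (Fin.le_def.2 (by omega)).trans hab

theorem sum_eq_sum_peelDiag {n : ℕ} {H : Fin (n + 1) → Fin (n + 1) → ℕ}
    (hH : ∀ i j, H i j = H j i) :
    ∑ i, ∑ j, H i j = ∑ i, H i i + (∑ i, peelDiag H i i + ∑ i, ∑ j, peelDiag H i j) := by
  rw [sum_congr rfl fun i _ => Fin.sum_univ_succAbove (H i) i, sum_add_distrib]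
  congr 1
  rw [sum_comm, ← sum_add_distrib]
  refine sum_congr rfl fun j _ => ?_
  rw [Fin.sum_univ_succAbove _ j.succ]
  congr 1
  · rw [Fin.succAbove_of_castSucc_lt _ _ (Fin.castSucc_lt_succ), hH]
    simp [peelDiag]
  · refine sum_congr rfl fun k _ => ?_
    rcases le_or_gt k j with h | h
    · rw [Fin.succAbove_of_castSucc_lt j.succ k (Fin.castSucc_lt_succ_iff.2 h),
        Fin.succAbove_of_le_castSucc k.castSucc j (Fin.castSucc_le_castSucc_iff.2 h), peelDiag,
        min_eq_right h, max_eq_left h]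
    · rw [Fin.succAbove_of_le_castSucc j.succ k (Fin.succ_le_castSucc_iff.2 h),
        Fin.succAbove_of_castSucc_lt k.succ j (Fin.castSucc_lt_succ_iff.2 h.le), peelDiag,
        min_eq_left h.le, max_eq_right h.le, hH]

theorem sum_symArrays_succ_diag_eq {K : Type*} [Field K] (q : K) {n c : ℕ} {d : Fin (n + 1) → ℕ}
    (hc : ∀ i, d i ≤ c) :
    ∑ H ∈ symArrays (n + 1) c with (fun i => H i i) = d, q ^ (∑ i, ∑ j, H i j) =
      q ^ (∑ i, d i) * ∑ H ∈ symArrays n c with (fun i => H i i) ∈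
        Fintype.piFinset fun i : Fin n => Icc (d i.succ) (d i.castSucc),
          q ^ (∑ i, H i i + ∑ i, ∑ j, H i j) := by
  rw [mul_sum]
  refine sum_bij' (fun H _ => peelDiag H) (fun H _ => attachDiag d H) ?_ ?_ ?_ ?_ ?_
  · intro H hH
    simp only [mem_filter, Fintype.mem_piFinset, mem_Icc] at hH ⊢
    obtain ⟨hH, rfl⟩ := hH
    refine ⟨peelDiag_mem hH, fun i => ⟨?_, ?_⟩⟩
    · exact le_of_mem_symArrays hH (by simp [Fin.castSucc_le_succ]) (by simp)
    · exact le_of_mem_symArrays hH (by simp) (by simp [Fin.castSucc_le_succ])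
  · intro H hH
    simp only [mem_filter, Fintype.mem_piFinset, mem_Icc] at hH ⊢
    exact ⟨attachDiag_mem hc hH.1 hH.2, funext fun i => attachDiag_self d H i⟩
  · intro H hH
    rw [mem_filter] at hH
    obtain ⟨hH, rfl⟩ := hH
    have hs := (mem_symArrays.1 hH).2.1
    funext i j
    rcases lt_trichotomy i j with h | rfl | h
    · obtain ⟨a, b, hab, rfl, rfl⟩ := exists_castSucc_succ h
      rw [attachDiag_castSucc_succ _ _ hab, peelDiag, min_eq_left hab, max_eq_right hab]
    · rw [attachDiag_self]
    · obtain ⟨a, b, hab, rfl, rfl⟩ := exists_castSucc_succ h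
      rw [attachDiag_comm, attachDiag_castSucc_succ _ _ hab, peelDiag, min_eq_left hab,
        max_eq_right hab, hs]
  · intro H hH
    rw [mem_filter] at hH
    have hs := (mem_symArrays.1 hH.1).2.1
    funext i j
    rw [peelDiag, attachDiag_castSucc_succ _ _ min_le_max]
    rcases le_total i j with h | h
    · rw [min_eq_left h, max_eq_right h]
    · rw [min_eq_right h, max_eq_left h, hs]
  · intro H hH
    rw [mem_filter] at hH
    obtain ⟨hH, rfl⟩ := hH
    have hs := (mem_symArrays.1 hH).2.1
    rw [sum_eq_sum_peelDiag hs, pow_add]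

theorem sum_symArrays_diag_eq {K : Type*} [Field K] (q : K) (n c : ℕ) (d : Fin n → ℕ)
    (hd : Antitone d) (hc : ∀ i, d i ≤ c) :
    ∑ H ∈ symArrays n c with (fun i => H i i) = d, q ^ (∑ i, ∑ j, H i j) =
      interlacingSum q n d := by
  induction n with
  | zero =>
    have : (symArrays 0 c).filter (fun H => (fun i => H i i) = d) = {fun i => i.elim0} := by
      ext H
      simp only [mem_filter, mem_symArrays, mem_singleton]
      exact ⟨fun _ => Subsingleton.elim _ _, fun _ => ⟨⟨fun i => i.elim0, fun i => i.elim0,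
        fun i => i.elim0⟩, Subsingleton.elim _ _⟩⟩
    simp [this, interlacingSum]
  | succ n ih =>
    have hbox : ∀ e ∈ Fintype.piFinset fun i : Fin n => Icc (d i.succ) (d i.castSucc),
        q ^ (∑ i, e i) * interlacingSum q n e =
        ∑ H ∈ (symArrays n c).filter (fun H => (fun i => H i i) ∈
          Fintype.piFinset fun i : Fin n => Icc (d i.succ) (d i.castSucc)) with
          (fun i => H i i) = e, q ^ (∑ i, H i i + ∑ i, ∑ j, H i j) := by
      intro e he
      have he' := he
      simp only [Fintype.mem_piFinset, mem_Icc] at he'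
      rw [← ih e, filter_filter, mul_sum]
      · refine sum_congr ?_ fun H hH => ?_
        · ext H
          simp only [mem_filter, and_congr_right_iff]
          exact fun _ => ⟨fun h => ⟨h ▸ he, h⟩, fun h => h.2⟩
        · rw [← (mem_filter.1 hH).2.2, pow_add]
      · exact antitone_of_mem_piFinset_Icc hd he
      · exact fun i => (he' i).2.trans (hc _)
    rw [interlacingSum, sum_congr rfl hbox, sum_fiberwise_of_maps_to]
    · exact sum_symArrays_succ_diag_eq q hc
    · exact fun H hH => (mem_filter.1 hH).2

end SymmetricArrays

section SymmetricCount

open Matrix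

theorem StrictAnti.antitone_add_val {n : ℕ} {l : Fin n → ℕ} (hl : StrictAnti l) :
    Antitone fun i => l i + i := by
  cases n with
  | zero => exact fun i => i.elim0
  | succ n =>
    refine Fin.antitone_iff_succ_le.2 fun i => ?_
    have := hl (Fin.castSucc_lt_succ (i := i))
    simp
    omega

theorem StrictAnti.sub_le_val {n : ℕ} {l : Fin n → ℕ} (hl : StrictAnti l) (i : Fin n) :
    n - 1 - i ≤ l i := by
  have hi := i.isLt
  have := hl.antitone_add_val (show i ≤ ⟨n - 1, by omega⟩ from Fin.le_def.2 (by simp; omega))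
  simp only at this
  omega

variable {K : Type*} [Field K]

theorem exists_mul_sum_symArrays_eq (q : K) (hq : q ≠ 0)
    (hinj : Function.Injective fun k : ℕ => q ^ k) (n : ℕ) :
    ∃ C : K, C ≠ 0 ∧ ∀ c : ℕ, C * ∑ H ∈ symArrays n c, q ^ (∑ i, ∑ j, H i j) =
      alternantSum n (n + c) fun j => q ^ (2 * (j : ℕ) + 1) := by
  obtain ⟨C, hC, h⟩ := exists_interlacingSum_eq q hq hinj n
  refine ⟨C, hC, fun c => ?_⟩
  have hmaps : ∀ H ∈ symArrays n c,
      (fun j : Fin n => H j j + (n - 1 - j : ℕ)) ∈ strictAntiTuples n (n + c) := by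
    refine fun H hH => mem_strictAntiTuples.2 ⟨fun i => ?_, fun i j hij => ?_⟩
    · have := (mem_symArrays.1 hH).1 i i
      omega
    · have := le_of_mem_symArrays hH hij.le hij.le
      have := Fin.lt_def.1 hij
      simp only
      omega
  rw [← sum_fiberwise_of_maps_to hmaps, mul_sum, alternantSum]
  refine sum_congr rfl fun l hl => ?_
  obtain ⟨hlt, hanti⟩ := mem_strictAntiTuples.1 hl
  have hsub := hanti.sub_le_val
  have hd : Antitone fun j : Fin n => l j - (n - 1 - j : ℕ) := by
    intro i j hij
    have := hanti.antitone_add_val hij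
    have := hsub i
    have := hsub j
    have := Fin.le_def.1 hij
    simp only at *
    omega
  have hle : ∀ j : Fin n, l j - (n - 1 - j : ℕ) ≤ c := by
    intro j
    have := hanti.antitone_add_val (show ⟨0, j.pos⟩ ≤ j from Fin.le_def.2 (by simp))
    have := hlt ⟨0, j.pos⟩
    simp only at *
    omega
  have hfilter : (symArrays n c).filter (fun H => (fun j : Fin n => H j j + (n - 1 - j : ℕ)) = l) =
      (symArrays n c).filter fun H =>
        (fun j => H j j) = fun j : Fin n => l j - (n - 1 - j : ℕ) := by
    refine filter_congr fun H _ => ?_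
    rw [funext_iff, funext_iff]
    refine forall_congr' fun j => ?_
    have := hsub j
    omega
  rw [hfilter, sum_symArrays_diag_eq q n c _ hd hle, h _ hd]
  congr 1
  ext i j
  simp only [of_apply, Nat.sub_add_cancel (hsub j)]

theorem symArrays_zero_right (n : ℕ) : symArrays n 0 = {fun _ _ => 0} := by
  ext H
  rw [mem_symArrays, mem_singleton]
  constructor
  · exact fun h => funext fun i => funext fun j => Nat.le_zero.1 (h.1 i j)
  · rintro rfl
    exact ⟨fun _ _ => le_rfl, fun _ _ => rfl, fun _ => antitone_const⟩

theorem sum_symArrays_mul_prod (q : K) (hq : q ≠ 0)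
    (hinj : Function.Injective fun k : ℕ => q ^ k) (hneg : ∀ k : ℕ, q ^ k ≠ -1) (n c : ℕ) :
    (∑ H ∈ symArrays n c, q ^ (∑ i, ∑ j, H i j)) *
        ((∏ i : Fin n, (1 - q ^ (2 * (i : ℕ) + 1))) *
          ∏ a : Fin n, ∏ b ∈ Ioi a, (1 - q ^ (2 * ((a : ℕ) + b + 1)))) =
      (∏ i : Fin n, (1 - q ^ (c + 2 * (i : ℕ) + 1))) *
        ∏ a : Fin n, ∏ b ∈ Ioi a, (1 - q ^ (2 * (c + (a : ℕ) + b + 1))) := by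
  obtain ⟨C, -, hC⟩ := exists_mul_sum_symArrays_eq q hq hinj n
  obtain ⟨D, hD, h⟩ := exists_reflDet_odd_pow_eq n q hq hinj
  have hx : Function.Injective fun j : Fin n => q ^ (2 * (j : ℕ) + 1) := fun i j hij =>
    Fin.ext (by have : 2 * (i : ℕ) + 1 = 2 * j + 1 := hinj hij; omega)
  have key : ∀ c, (C * reflDenom n fun j : Fin n => q ^ (2 * (j : ℕ) + 1)) *
      ∑ H ∈ symArrays n c, q ^ (∑ i, ∑ j, H i j) = _ := fun c => by
    rw [mul_right_comm, hC, alternantSum_mul_reflDenom _ _ _ (fun j => pow_ne_zero _ hq)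
      (fun j => hneg _) hx, h c]
  have h0 := key 0
  simp only [symArrays_zero_right, sum_singleton, sum_const_zero, pow_zero, mul_one,
    zero_add] at h0
  have hc := key c
  rw [h0, mul_assoc] at hc
  rw [← mul_left_cancel₀ hD hc, mul_comm]

end SymmetricCount

section PlanePartitions

theorem mem_iff_lt_card {c : ℕ} {S : Finset (Fin c)} (hS : ∀ k ∈ S, ∀ l ≤ k, l ∈ S)
    (k : Fin c) : k ∈ S ↔ (k : ℕ) < #S := by
  constructor
  · intro hk
    have := card_le_card (show Iic k ⊆ S from fun l hl => hS k hk l (mem_Iic.1 hl))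
    rw [Fin.card_Iic] at this
    omega
  · intro hk
    by_contra h
    have := card_le_card (show S ⊆ Iio k from fun l hl => mem_Iio.2
      (lt_of_not_ge fun hkl => h (hS l hl k hkl)))
    rw [Fin.card_Iio] at this
    omega

/-- The heights of the columns of a set of cubes. -/
def columnHeights {a c : ℕ} (T : Finset (Fin a × Fin a × Fin c)) (i j : Fin a) : ℕ :=
  #{k : Fin c | (i, j, k) ∈ T}

theorem sum_columnHeights {a c : ℕ} (T : Finset (Fin a × Fin a × Fin c)) :
    ∑ i, ∑ j, columnHeights T i j = #T := by
  simp only [columnHeights, card_filter, ← Fintype.sum_prod_type']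
  simp

theorem IsPP.mem_iff_lt_columnHeights {a c : ℕ} {T : Finset (Fin a × Fin a × Fin c)}
    (hT : IsPP a a c T) (i j : Fin a) (k : Fin c) :
    (i, j, k) ∈ T ↔ (k : ℕ) < columnHeights T i j := by
  rw [columnHeights, ← mem_iff_lt_card, mem_filter]
  · simp
  · simp only [mem_filter, mem_univ, true_and]
    exact fun k hk l hl => hT _ hk _ le_rfl le_rfl hl

theorem mem_ppTau {a c : ℕ} {T : Finset (Fin a × Fin a × Fin c)} (i j : Fin a) (k : Fin c) :
    (i, j, k) ∈ ppTau a c T ↔ (j, i, k) ∈ T := by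
  simp only [ppTau, mem_image, Prod.mk.injEq, Prod.exists]
  constructor
  · rintro ⟨_, _, _, h, rfl, rfl, rfl⟩
    exact h
  · exact fun h => ⟨_, _, _, h, rfl, rfl, rfl⟩

theorem columnHeights_mem_symArrays {a c : ℕ} {T : Finset (Fin a × Fin a × Fin c)}
    (hT : IsPP a a c T) (hτ : ppTau a c T = T) : columnHeights T ∈ symArrays a c := by
  refine mem_symArrays.2 ⟨fun i j => ?_, fun i j => ?_,
    fun j i i' hi => card_le_card fun k hk => ?_⟩
  · exact (card_le_univ _).trans_eq (Fintype.card_fin c)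
  · simp only [columnHeights]
    congr 1
    ext k
    rw [mem_filter, mem_filter, ← mem_ppTau, hτ]
  · rw [mem_filter] at hk ⊢
    exact ⟨mem_univ _, hT _ hk.2 _ hi le_rfl le_rfl⟩

theorem columnHeights_filter_lt {a c : ℕ} {H : Fin a → Fin a → ℕ} (hH : ∀ i j, H i j ≤ c) :
    columnHeights ({p : Fin a × Fin a × Fin c | (p.2.2 : ℕ) < H p.1 p.2.1} : Finset _) = H := by
  funext i j
  simp only [columnHeights, mem_filter, mem_univ, true_and]
  rw [Fin.card_filter_val_lt, min_eq_right (hH i j)]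

theorem sum_symmetric_isPP_eq {R : Type*} [CommSemiring R] (q : R) (a c : ℕ) :
    ∑ T : Finset (Fin a × Fin a × Fin c) with IsPP a a c T ∧ ppTau a c T = T, q ^ #T =
      ∑ H ∈ symArrays a c, q ^ (∑ i, ∑ j, H i j) := by
  refine sum_bij' (fun T _ => columnHeights T)
    (fun H _ => ({p : Fin a × Fin a × Fin c | (p.2.2 : ℕ) < H p.1 p.2.1} : Finset _))
    ?_ ?_ ?_ ?_ ?_
  · intro T hT
    rw [mem_filter] at hT
    exact columnHeights_mem_symArrays hT.2.1 hT.2.2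
  · intro H hH
    rw [mem_filter]
    refine ⟨mem_univ _, fun p hp r h1 h2 h3 => ?_, ?_⟩
    · rw [mem_filter] at hp ⊢
      exact ⟨mem_univ _, (Fin.le_def.1 h3).trans_lt (hp.2.trans_le (le_of_mem_symArrays hH h1 h2))⟩
    · ext ⟨i, j, k⟩
      rw [mem_ppTau, mem_filter, mem_filter]
      simp only [mem_univ, true_and]
      rw [(mem_symArrays.1 hH).2.1 j i]
  · intro T hT
    rw [mem_filter] at hT
    ext ⟨i, j, k⟩
    rw [mem_filter, hT.2.1.mem_iff_lt_columnHeights]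
    simp
  · exact fun H hH => columnHeights_filter_lt (mem_symArrays.1 hH).1
  · intro T _
    rw [sum_columnHeights]

theorem sum_symArrays_X_mul_prod (n c : ℕ) :
    (∑ H ∈ symArrays n c, (X : ℤ[X]) ^ (∑ i, ∑ j, H i j)) *
        ((∏ i : Fin n, (1 - (X : ℤ[X]) ^ (2 * (i : ℕ) + 1))) *
          ∏ a : Fin n, ∏ b ∈ Ioi a, (1 - (X : ℤ[X]) ^ (2 * ((a : ℕ) + b + 1)))) =
      (∏ i : Fin n, (1 - (X : ℤ[X]) ^ (c + 2 * (i : ℕ) + 1))) *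
        ∏ a : Fin n, ∏ b ∈ Ioi a, (1 - (X : ℤ[X]) ^ (2 * (c + (a : ℕ) + b + 1))) := by
  have hφ := IsFractionRing.injective ℤ[X] (FractionRing ℤ[X])
  have h := sum_symArrays_mul_prod (algebraMap ℤ[X] (FractionRing ℤ[X]) X)
    (fun h => X_ne_zero ((map_eq_zero_iff _ hφ).1 h))
    (fun k l hkl => by
      simp only [← map_pow] at hkl
      simpa using congrArg natDegree (hφ hkl))
    (fun k hk => by
      rw [← map_pow, ← map_one (algebraMap ℤ[X] (FractionRing ℤ[X])), ← map_neg] at hk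
      simpa using congrArg (eval 1) (hφ hk)) n c
  refine hφ ?_
  simpa only [map_mul, map_sum, map_prod, map_sub, map_one, map_pow] using h

theorem prod_filter_lt_eq_prod_Ioi {M : Type*} [CommMonoid M] {n : ℕ} (f : Fin n × Fin n → M) :
    ∏ p : Fin n × Fin n with p.1 < p.2, f p = ∏ a, ∏ b ∈ Ioi a, f (a, b) := by
  rw [prod_filter, Fintype.prod_prod_type]
  refine prod_congr rfl fun a _ => ?_
  rw [← prod_filter]
  congr 1
  ext b
  simp

end PlanePartitions

/-- Andrews' theorem (MacMahon's conjecture): the generating function for symmetric plane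
partitions in an `a × a × c` box satisfies, in `ℤ[q]`,
`(∑_{τ(T)=T} q^|T|) ∏_{i=1}^a (1-q^{2i-1}) ∏_{1 ≤ i<j ≤ a} (1-q^{2(i+j-1)})
  = ∏_{i=1}^a (1-q^{c+2i-1}) ∏_{1 ≤ i<j ≤ a} (1-q^{2(c+i+j-1)})`.
(Below, indices `i, j : Fin a` are zero-based, so `i+1`, `j+1` range over `1, …, a`.) -/
theorem symmetric_planePartition_qcount (a c : ℕ) :
    (∑ T ∈ Finset.univ.filter fun T : Finset (Fin a × Fin a × Fin c) =>
          IsPP a a c T ∧ ppTau a c T = T, (X : Polynomial ℤ) ^ T.card) *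
        (∏ i : Fin a, (1 - (X : Polynomial ℤ) ^ (2 * ((i : ℕ) + 1) - 1))) *
        (∏ p ∈ Finset.univ.filter fun p : Fin a × Fin a => p.1 < p.2,
          (1 - (X : Polynomial ℤ) ^ (2 * (((p.1 : ℕ) + 1) + ((p.2 : ℕ) + 1) - 1)))) =
      (∏ i : Fin a, (1 - (X : Polynomial ℤ) ^ (c + 2 * ((i : ℕ) + 1) - 1))) *
        (∏ p ∈ Finset.univ.filter fun p : Fin a × Fin a => p.1 < p.2,
          (1 - (X : Polynomial ℤ) ^ (2 * (c + ((p.1 : ℕ) + 1) + ((p.2 : ℕ) + 1) - 1)))) := by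
  have hcast : ∀ i : ℕ, 2 * (i + 1) - 1 = 2 * i + 1 := fun i => by omega
  have hcast₂ : ∀ i j : ℕ, i + 1 + (j + 1) - 1 = i + j + 1 := fun i j => by omega
  have hcast₃ : ∀ i : ℕ, c + 2 * (i + 1) - 1 = c + 2 * i + 1 := fun i => by omega
  have hcast₄ : ∀ i j : ℕ, c + (i + 1) + (j + 1) - 1 = c + i + j + 1 := fun i j => by omega
  simp only [prod_filter_lt_eq_prod_Ioi, hcast, hcast₂, hcast₃, hcast₄]
  rw [sum_symmetric_isPP_eq, mul_assoc]
  exact sum_symArrays_X_mul_prod a c
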